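/- Let α ∈ (0,1), θ ∈ (0,α), p > 1/(α−θ), and μ ∈ (1/(αp), (α−θ)/α). For the solution operator T_t^1 φ = p(t,·) * φ of ∂_t^α u = Δu with φ ∈ C_c^∞(ℝ^d), one has for all 0 < s < t < T: ‖T_t^1 φ − T_s^1 φ‖_{H_p^{2θ/α − 2}}^p ≤ N(α,θ,d,p,T) |t−s|^{αμp − 1} ‖φ‖_{L_p}^p. -/

import Mathlib

open MeasureTheory Set
open scoped ENNReal FourierTransform Convolution

/-- The Mittag-Leffler function `E_α(z) = Σ_{k≥0} z^k / Γ(αk+1)` (real argument). -/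
noncomputable def mittagLeffler (α z : ℝ) : ℝ :=
  ∑' k : ℕ, z ^ k / Real.Gamma (α * k + 1)

/-- The Bessel potential space norm `‖u‖_{H_p^γ} = ‖(1−Δ)^{γ/2} u‖_{L_p}`,
defined via the Fourier transform. -/
noncomputable def besselNorm {d : ℕ} (γ : ℝ) (q : ℝ≥0∞)
    (u : EuclideanSpace ℝ (Fin d) → ℂ) : ℝ≥0∞ :=
  eLpNorm (𝓕⁻ (fun ξ : EuclideanSpace ℝ (Fin d) =>
    ((1 + ‖ξ‖ ^ 2 : ℝ) : ℂ) ^ (((γ / 2 : ℝ)) : ℂ) * 𝓕 u ξ)) q volume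

section TranslationMultipliers

variable {E Ω : Type*} [NormedAddCommGroup E] [InnerProductSpace ℝ E] [FiniteDimensional ℝ E]
  [MeasurableSpace E] [BorelSpace E] [MeasurableSpace Ω]

/-- Averaging translates of a function against a finite signed density is bounded on `L^q`. -/
lemma eLpNorm_integral_translate_le (ρ : Measure Ω) [SFinite ρ] {Y : Ω → E} (hY : Measurable Y)
    {w : Ω → ℝ} (hw : Integrable w ρ) {f : E → ℂ} (hf : Continuous f) {q : ℝ} (hq : 1 ≤ q) :
    eLpNorm (fun x => ∫ ω, (w ω : ℂ) * f (x - Y ω) ∂ρ) (ENNReal.ofReal q) volume ≤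
      ENNReal.ofReal (∫ ω, |w ω| ∂ρ) * eLpNorm f (ENNReal.ofReal q) volume := by
  have hq0 : 0 < q := by linarith
  set ρ' : Measure Ω := ρ.withDensity (fun ω => ‖w ω‖ₑ) with hρ'
  have hwm : AEMeasurable (fun ω => ‖w ω‖ₑ) ρ := hw.aestronglyMeasurable.enorm
  have hmass : ENNReal.ofReal (∫ ω, |w ω| ∂ρ) = ρ' univ := by
    rw [hρ', withDensity_apply _ MeasurableSet.univ, setLIntegral_univ,
      ← ofReal_integral_norm_eq_lintegral_enorm hw]
    simp only [Real.norm_eq_abs]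
  have hF : Measurable (fun z : E × Ω => ‖f (z.1 - Y z.2)‖ₑ ^ q) := by
    have : Measurable (fun z : E × Ω => f (z.1 - Y z.2)) :=
      hf.measurable.comp (measurable_fst.sub (hY.comp measurable_snd))
    exact this.enorm.pow_const q
  have hpt : ∀ x : E, ‖∫ ω, (w ω : ℂ) * f (x - Y ω) ∂ρ‖ₑ ^ q ≤
      ρ' univ ^ (q - 1) * ∫⁻ ω, ‖f (x - Y ω)‖ₑ ^ q ∂ρ' := by
    intro x
    have hfx : Measurable (fun ω => f (x - Y ω)) :=
      hf.measurable.comp (measurable_const.sub hY)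
    have h1 : ‖∫ ω, (w ω : ℂ) * f (x - Y ω) ∂ρ‖ₑ ≤ ∫⁻ ω, ‖f (x - Y ω)‖ₑ ∂ρ' := by
      refine (enorm_integral_le_lintegral_enorm _).trans (le_of_eq ?_)
      rw [hρ', lintegral_withDensity_eq_lintegral_mul₀ hwm hfx.enorm.aemeasurable]
      refine lintegral_congr fun ω => ?_
      simp [enorm_eq_nnnorm]
    have h2 := eLpNorm'_le_eLpNorm'_mul_rpow_measure_univ (p := 1) (q := q) one_pos hq
      (hfx.aestronglyMeasurable (μ := ρ'))
    rw [eLpNorm'_eq_lintegral_enorm, eLpNorm'_eq_lintegral_enorm] at h2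
    simp only [ENNReal.rpow_one, div_one] at h2
    refine (ENNReal.rpow_le_rpow (h1.trans h2) hq0.le).trans (le_of_eq ?_)
    rw [ENNReal.mul_rpow_of_nonneg _ _ hq0.le, ← ENNReal.rpow_mul, ← ENNReal.rpow_mul,
      one_div_mul_cancel hq0.ne', ENNReal.rpow_one, mul_comm]
    congr 2
    field_simp
  have hintegral : ∫⁻ x, ‖∫ ω, (w ω : ℂ) * f (x - Y ω) ∂ρ‖ₑ ^ q ≤
      ρ' univ ^ q * ∫⁻ x, ‖f x‖ₑ ^ q := by
    calc ∫⁻ x, ‖∫ ω, (w ω : ℂ) * f (x - Y ω) ∂ρ‖ₑ ^ q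
        ≤ ∫⁻ x, ρ' univ ^ (q - 1) * ∫⁻ ω, ‖f (x - Y ω)‖ₑ ^ q ∂ρ' := lintegral_mono hpt
      _ = ρ' univ ^ (q - 1) * ∫⁻ x, ∫⁻ ω, ‖f (x - Y ω)‖ₑ ^ q ∂ρ' :=
          lintegral_const_mul _ hF.lintegral_prod_right'
      _ = ρ' univ ^ (q - 1) * ∫⁻ ω, (∫⁻ x, ‖f (x - Y ω)‖ₑ ^ q) ∂ρ' := by
          rw [lintegral_lintegral_swap hF.aemeasurable]
      _ = ρ' univ ^ (q - 1) * ∫⁻ _, (∫⁻ x, ‖f x‖ₑ ^ q) ∂ρ' := by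
          congr 1
          refine lintegral_congr fun ω => ?_
          exact lintegral_sub_right_eq_self (fun x => ‖f x‖ₑ ^ q) (Y ω)
      _ = ρ' univ ^ q * ∫⁻ x, ‖f x‖ₑ ^ q := by
          rw [lintegral_const, mul_comm (∫⁻ x, ‖f x‖ₑ ^ q), ← mul_assoc]
          congr 1
          conv_rhs => rw [show q = (q - 1) + 1 by ring,
            ENNReal.rpow_add_of_nonneg _ _ (by linarith) zero_le_one, ENNReal.rpow_one]
  rw [eLpNorm_eq_lintegral_rpow_enorm_toReal (by simpa using hq0) ENNReal.ofReal_ne_top,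
    eLpNorm_eq_lintegral_rpow_enorm_toReal (by simpa using hq0) ENNReal.ofReal_ne_top,
    ENNReal.toReal_ofReal hq0.le, hmass]
  refine (ENNReal.rpow_le_rpow hintegral (by positivity)).trans (le_of_eq ?_)
  rw [ENNReal.mul_rpow_of_nonneg _ _ (by positivity), ← ENNReal.rpow_mul,
    mul_one_div_cancel hq0.ne', ENNReal.rpow_one]

/-- A Fourier multiplier that is an average of characters acts as an average of translations. -/
lemma fourierInv_mul_fourier_eq_integral_translate (ρ : Measure Ω) [SFinite ρ] {Y : Ω → E}
    (hY : Measurable Y) {w : Ω → ℝ} (hw : Integrable w ρ) (f : SchwartzMap E ℂ) (x : E) :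
    𝓕⁻ (fun ξ : E => (∫ ω, (w ω : ℂ) * ((Real.fourierChar (-inner ℝ (Y ω) ξ) : Circle) : ℂ) ∂ρ) *
      𝓕 (f : E → ℂ) ξ) x = ∫ ω, (w ω : ℂ) * f (x - Y ω) ∂ρ := by
  have hfi : Integrable (𝓕 (f : E → ℂ)) := by
    rw [← SchwartzMap.fourier_coe]
    exact (𝓕 f).integrable
  have hinv : ∀ y : E,
      f y = ∫ ξ, ((Real.fourierChar (inner ℝ ξ y) : Circle) : ℂ) * 𝓕 (f : E → ℂ) ξ := by
    intro y
    have h := congrFun (f.continuous.fourierInv_fourier_eq f.integrable hfi) y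
    rw [← h, Real.fourierInv_eq]
    simp [Circle.smul_def]
  have hker : Integrable (fun z : E × Ω =>
      ((Real.fourierChar (inner ℝ z.1 (x - Y z.2)) : Circle) : ℂ) *
      (𝓕 (f : E → ℂ) z.1 * (w z.2 : ℂ))) (volume.prod ρ) := by
    refine (hfi.mul_prod hw.ofReal).bdd_mul (c := 1) ?_ ?_
    · have hm : Measurable (fun z : E × Ω => inner ℝ z.1 (x - Y z.2)) :=
        measurable_fst.inner (measurable_const.sub (hY.comp measurable_snd))
      exact ((continuous_subtype_val.comp Real.continuous_fourierChar).measurable.comp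
        hm).aestronglyMeasurable
    · exact Filter.Eventually.of_forall fun z => (Circle.norm_coe _).le
  rw [Real.fourierInv_eq]
  calc ∫ ξ, Real.fourierChar (inner ℝ ξ x) •
        ((∫ ω, (w ω : ℂ) * ((Real.fourierChar (-inner ℝ (Y ω) ξ) : Circle) : ℂ) ∂ρ) *
          𝓕 (f : E → ℂ) ξ)
      = ∫ ξ, ∫ ω, ((Real.fourierChar (inner ℝ ξ (x - Y ω)) : Circle) : ℂ) *
          (𝓕 (f : E → ℂ) ξ * (w ω : ℂ)) ∂ρ := by
        refine integral_congr_ae (Filter.Eventually.of_forall fun ξ => ?_)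
        simp only [Circle.smul_def, smul_eq_mul]
        rw [← integral_mul_const, ← integral_const_mul]
        refine integral_congr_ae (Filter.Eventually.of_forall fun ω => ?_)
        have he : Real.fourierChar (inner ℝ ξ (x - Y ω)) =
            Real.fourierChar (inner ℝ ξ x) * Real.fourierChar (-inner ℝ (Y ω) ξ) := by
          rw [← AddChar.map_add_eq_mul, inner_sub_right, real_inner_comm ξ (Y ω), sub_eq_add_neg]
        simp only [he, Circle.coe_mul]
        ring
    _ = ∫ ω, (∫ ξ, ((Real.fourierChar (inner ℝ ξ (x - Y ω)) : Circle) : ℂ) *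
          (𝓕 (f : E → ℂ) ξ * (w ω : ℂ))) ∂ρ := integral_integral_swap hker
    _ = ∫ ω, (w ω : ℂ) * f (x - Y ω) ∂ρ := by
        refine integral_congr_ae (Filter.Eventually.of_forall fun ω => ?_)
        simp only
        rw [hinv, ← integral_const_mul]
        refine integral_congr_ae (Filter.Eventually.of_forall fun ξ => ?_)
        simp only
        ring

/-- A multiplier that is a superposition `∫ w(ω) e^{-V(ω)|ξ|²} dρ(ω)` of heat multipliers is
bounded on `L^q` by the total mass of the signed density `w`. -/
lemma eLpNorm_heat_superposition_le (ρ : Measure Ω) [SFinite ρ] {V : Ω → ℝ} (hV : Measurable V)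
    (hV0 : ∀ ω, 0 ≤ V ω) {w : Ω → ℝ} (hw : Integrable w ρ) (f : SchwartzMap E ℂ)
    {q : ℝ} (hq : 1 ≤ q) :
    eLpNorm (𝓕⁻ (fun ξ : E => ((∫ ω, w ω * Real.exp (-(V ω * ‖ξ‖ ^ 2)) ∂ρ : ℝ) : ℂ) *
      𝓕 (f : E → ℂ) ξ)) (ENNReal.ofReal q) volume ≤
      ENNReal.ofReal (∫ ω, |w ω| ∂ρ) * eLpNorm f (ENNReal.ofReal q) volume := by
  set c : ℝ := Real.pi ^ (Module.finrank ℝ E / 2 : ℝ) with hc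
  have hc0 : 0 ≤ c := by positivity
  set G : E → ℝ := fun z => c * Real.exp (-(Real.pi ^ 2 * ‖z‖ ^ 2)) with hG
  have hG0 : ∀ z, 0 ≤ G z := fun z => by positivity
  have hpi2 : (0 : ℝ) < ((Real.pi ^ 2 : ℝ) : ℂ).re := by
    rw [Complex.ofReal_re]; positivity
  have hGF : ∀ ξ : E, ∫ z, (G z : ℂ) * ((Real.fourierChar (-inner ℝ z ξ) : Circle) : ℂ) =
      (Real.exp (-‖ξ‖ ^ 2) : ℂ) := by
    intro ξ
    have h := fourier_gaussian_innerProductSpace (V := E) hpi2 ξ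
    rw [Real.fourier_eq] at h
    have : ∀ z : E, (G z : ℂ) * ((Real.fourierChar (-inner ℝ z ξ) : Circle) : ℂ) =
        (c : ℂ) * (Real.fourierChar (-inner ℝ z ξ) •
          Complex.exp (-((Real.pi ^ 2 : ℝ) : ℂ) * ‖z‖ ^ 2)) := by
      intro z
      simp only [hG, Circle.smul_def, smul_eq_mul]
      push_cast
      ring_nf
    simp_rw [this]
    rw [integral_const_mul, h]
    have hpi : (Real.pi : ℝ) ≠ 0 := Real.pi_ne_zero
    have h1 : ((Real.pi : ℂ) / ((Real.pi ^ 2 : ℝ) : ℂ)) ^ (Module.finrank ℝ E / 2 : ℂ) =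
        ((Real.pi⁻¹ ^ (Module.finrank ℝ E / 2 : ℝ) : ℝ) : ℂ) := by
      rw [Complex.ofReal_cpow (by positivity)]
      congr 1
      · push_cast; field_simp
      · push_cast; rfl
    rw [h1, ← mul_assoc, ← Complex.ofReal_mul, hc, ← Real.mul_rpow (by positivity) (by positivity),
      mul_inv_cancel₀ hpi, Real.one_rpow]
    push_cast
    rw [one_mul]
    congr 1
    field_simp
  have hG1 : ∫ z, G z = 1 := by
    have h := hGF 0
    simp only [inner_zero_right, neg_zero, AddChar.map_zero_eq_one, Circle.coe_one, mul_one,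
      norm_zero] at h
    have h2 : ∫ z, (G z : ℂ) = ((∫ z, G z : ℝ) : ℂ) := integral_ofReal
    rw [h2] at h
    have h' : (∫ z, G z) = Real.exp (-0 ^ 2) := by exact_mod_cast h
    simpa using h'
  have hGint : Integrable G := by
    by_contra h
    rw [integral_undef h] at hG1
    exact zero_ne_one hG1
  have hY : Measurable (fun z : Ω × E => Real.sqrt (V z.1) • z.2) :=
    (hV.comp measurable_fst).sqrt.smul measurable_snd
  have hW : Integrable (fun z : Ω × E => w z.1 * G z.2) (ρ.prod volume) := hw.mul_prod hGint
  have hmult : ∀ ξ : E, ∫ z : Ω × E, ((w z.1 * G z.2 : ℝ) : ℂ) *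
      ((Real.fourierChar (-inner ℝ (Real.sqrt (V z.1) • z.2) ξ) : Circle) : ℂ) ∂(ρ.prod volume) =
      ((∫ ω, w ω * Real.exp (-(V ω * ‖ξ‖ ^ 2)) ∂ρ : ℝ) : ℂ) := by
    intro ξ
    rw [integral_prod]
    · refine Eq.trans ?_ integral_complex_ofReal
      refine integral_congr_ae (Filter.Eventually.of_forall fun ω => ?_)
      simp only [inner_smul_left, RCLike.conj_to_real]
      have h := hGF (Real.sqrt (V ω) • ξ)
      simp only [inner_smul_right, norm_smul, mul_pow, Real.norm_eq_abs, sq_abs,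
        Real.sq_sqrt (hV0 ω)] at h
      push_cast at h ⊢
      simp only [mul_assoc]
      rw [integral_const_mul, h]
    · refine (hW.ofReal (𝕜 := ℂ)).mul_bdd (c := 1) ?_ ?_
      · have hm : Measurable (fun z : Ω × E => -inner ℝ (Real.sqrt (V z.1) • z.2) ξ) :=
          (hY.inner measurable_const).neg
        exact ((continuous_subtype_val.comp Real.continuous_fourierChar).measurable.comp
          hm).aestronglyMeasurable
      · exact Filter.Eventually.of_forall fun z => (Circle.norm_coe _).le
  have hmass : ∫ z : Ω × E, |w z.1 * G z.2| ∂(ρ.prod volume) = ∫ ω, |w ω| ∂ρ := by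
    simp only [abs_mul]
    rw [integral_prod_mul (fun ω => |w ω|) (fun z => |G z|)]
    simp only [abs_of_nonneg (hG0 _), hG1, mul_one]
  have key := eLpNorm_integral_translate_le (ρ.prod (volume : Measure E)) hY hW f.continuous hq
  rw [hmass] at key
  refine le_of_eq_of_le (congrArg (fun h => eLpNorm h _ _) ?_) key
  ext x
  rw [← fourierInv_mul_fourier_eq_integral_translate _ hY hW f x]
  simp_rw [hmult]

end TranslationMultipliers

section GammaDensity

/-- The density of the Gamma law with shape `b` and unit rate, vanishing on `(-∞, 0]`. -/
noncomputable def gammaDensity (b : ℝ) : ℝ → ℝ :=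
  (Ioi (0 : ℝ)).indicator fun v => Real.exp (-v) * v ^ (b - 1) / Real.Gamma b

lemma measurable_gammaDensity (b : ℝ) : Measurable (gammaDensity b) := by
  unfold gammaDensity
  exact Measurable.indicator (by fun_prop) measurableSet_Ioi

lemma gammaDensity_nonneg {b : ℝ} (hb : 0 < b) (v : ℝ) : 0 ≤ gammaDensity b v := by
  have := Real.Gamma_pos_of_pos hb
  refine indicator_nonneg (fun v hv => ?_) v
  have : (0 : ℝ) < v := hv
  positivity

lemma gammaDensity_of_nonpos {b v : ℝ} (hv : v ≤ 0) : gammaDensity b v = 0 :=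
  indicator_of_notMem (by simpa using hv) _

lemma gammaDensity_anti {b : ℝ} (hb : 0 < b) (hb1 : b < 1) {u v : ℝ} (hu : 0 < u) (huv : u ≤ v) :
    gammaDensity b v ≤ gammaDensity b u := by
  have hG := Real.Gamma_pos_of_pos hb
  have hv : 0 < v := hu.trans_le huv
  rw [gammaDensity, indicator_of_mem (show v ∈ Ioi (0 : ℝ) from hv),
    indicator_of_mem (show u ∈ Ioi (0 : ℝ) from hu)]
  have h1 : v ^ (b - 1) ≤ u ^ (b - 1) :=
    Real.rpow_le_rpow_of_nonpos hu huv (by linarith)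
  gcongr

lemma integrable_gammaDensity {b : ℝ} (hb : 0 < b) : Integrable (gammaDensity b) := by
  unfold gammaDensity
  rw [integrable_indicator_iff measurableSet_Ioi]
  exact (Real.GammaIntegral_convergent hb).div_const _

/-- The translated Gamma density has Laplace transform `(1 + l)^{-b} e^{-al}`. -/
lemma integral_gammaDensity_sub_mul_exp {b a l : ℝ} (hb : 0 < b) (ha : 0 ≤ a) (hl : 0 ≤ l) :
    ∫ v, gammaDensity b (v - a) * Real.exp (-(max v 0 * l)) =
      (1 + l) ^ (-b) * Real.exp (-(a * l)) := by
  have hG := Real.Gamma_pos_of_pos hb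
  have h1 : ∀ v, gammaDensity b (v - a) * Real.exp (-(max v 0 * l)) =
      (fun u => Real.exp (-(a * l)) * (gammaDensity b u * Real.exp (-(u * l)))) (v - a) := by
    intro v
    rcases le_or_gt (v - a) 0 with h | h
    · simp [gammaDensity_of_nonpos h]
    · have hv : 0 ≤ v := by linarith
      simp only [max_eq_left hv]
      rw [mul_left_comm, ← Real.exp_add]
      ring_nf
  simp_rw [h1]
  rw [integral_sub_right_eq_self (fun u => Real.exp (-(a * l)) *
    (gammaDensity b u * Real.exp (-(u * l)))) a, integral_const_mul, mul_comm]
  congr 1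
  have h2 : ∀ u, gammaDensity b u * Real.exp (-(u * l)) =
      (Ioi (0 : ℝ)).indicator
        (fun u => (Real.Gamma b)⁻¹ * (u ^ (b - 1) * Real.exp (-((1 + l) * u)))) u := by
    intro u
    by_cases hu : u ∈ Ioi (0 : ℝ)
    · rw [gammaDensity, indicator_of_mem hu, indicator_of_mem hu]
      rw [show -((1 + l) * u) = -u + -(u * l) by ring, Real.exp_add]
      field_simp
    · rw [gammaDensity, indicator_of_notMem hu, indicator_of_notMem hu, zero_mul]
  simp_rw [h2]
  rw [integral_indicator measurableSet_Ioi, integral_const_mul,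
    Real.integral_rpow_mul_exp_neg_mul_Ioi hb (by linarith), one_div,
    Real.inv_rpow (by linarith), Real.rpow_neg (by linarith)]
  field_simp

/-- The Gamma density of shape `b < 1` is `b`-Hölder continuous under translation in `L¹`. -/
lemma integral_abs_gammaDensity_sub_le {b : ℝ} (hb : 0 < b) (hb1 : b < 1) {a c : ℝ} (hca : c ≤ a) :
    ∫ v, |gammaDensity b (v - a) - gammaDensity b (v - c)| ≤
      2 / (b * Real.Gamma b) * (a - c) ^ b := by
  have hG := Real.Gamma_pos_of_pos hb
  have hi := integrable_gammaDensity hb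
  have hia := hi.comp_sub_right a
  have hic := hi.comp_sub_right c
  have hd : Integrable fun v => gammaDensity b (v - a) - gammaDensity b (v - c) := hia.sub hic
  set F : ℝ → ℝ := (Ioc 0 (a - c)).indicator fun v => v ^ (b - 1) / Real.Gamma b with hF
  have hFint : IntegrableOn (fun v : ℝ => v ^ (b - 1) / Real.Gamma b) (Ioc 0 (a - c)) := by
    refine Integrable.div_const ?_ _
    exact (intervalIntegrable_iff_integrableOn_Ioc_of_le (by linarith)).1
      (intervalIntegral.intervalIntegrable_rpow' (by linarith))
  have hFi : Integrable F := (integrable_indicator_iff measurableSet_Ioc).2 hFint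
  have hFval : ∫ v, F v = (a - c) ^ b / b / Real.Gamma b := by
    rw [hF, integral_indicator measurableSet_Ioc, integral_div,
      ← intervalIntegral.integral_of_le (by linarith), integral_rpow (Or.inl (by linarith))]
    simp [Real.zero_rpow hb.ne']
  have hpt : ∀ v, |gammaDensity b (v - a) - gammaDensity b (v - c)| ≤
      (gammaDensity b (v - a) - gammaDensity b (v - c)) + 2 * F (v - c) := by
    intro v
    have hF0 : 0 ≤ F (v - c) := by
      refine indicator_nonneg (fun v hv => ?_) _
      have : (0 : ℝ) < v := hv.1
      positivity
    have hle : gammaDensity b (v - c) - gammaDensity b (v - a) ≤ F (v - c) := by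
      rcases le_or_gt (v - c) 0 with h | h
      · rw [gammaDensity_of_nonpos h]
        linarith [gammaDensity_nonneg hb (v - a)]
      · rcases le_or_gt (v - a) 0 with h' | h'
        · rw [gammaDensity_of_nonpos h', sub_zero, gammaDensity,
            indicator_of_mem (show v - c ∈ Ioi (0 : ℝ) from h), hF,
            indicator_of_mem (show v - c ∈ Ioc (0 : ℝ) (a - c) from ⟨h, by linarith⟩)]
          have he : Real.exp (-(v - c)) ≤ 1 := Real.exp_le_one_iff.2 (by linarith)
          have : 0 ≤ (v - c) ^ (b - 1) := by positivity
          gcongr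
          nlinarith
        · linarith [gammaDensity_anti hb hb1 h' (show v - a ≤ v - c by linarith)]
    rw [abs_le]
    constructor <;> linarith
  calc ∫ v, |gammaDensity b (v - a) - gammaDensity b (v - c)|
      ≤ ∫ v, ((gammaDensity b (v - a) - gammaDensity b (v - c)) + 2 * F (v - c)) :=
        integral_mono hd.abs (hd.add ((hFi.comp_sub_right c).const_mul 2)) hpt
    _ = 2 / (b * Real.Gamma b) * (a - c) ^ b := by
        rw [integral_add hd ((hFi.comp_sub_right c).const_mul 2),
          integral_sub hia hic, integral_sub_right_eq_self, integral_sub_right_eq_self,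
          integral_const_mul, integral_sub_right_eq_self, hFval]
        field_simp
        ring

end GammaDensity

section Subordination

open Filter
open scoped Topology

/-- A law on `[0, 1]` whose `m`-th moment is `(α m + j + 1) / (m + j + 1)`: a mixture of a point
mass at `1` and a Beta law. -/
lemma exists_measure_moments_ratio {α : ℝ} (hα : α ∈ Ioo (0 : ℝ) 1) (j : ℕ) :
    ∃ ν : Measure ℝ, IsProbabilityMeasure ν ∧ (∀ᵐ x ∂ν, x ∈ Icc (0 : ℝ) 1) ∧
      ∀ m : ℕ, ∫ x, x ^ m ∂ν = (α * m + (j + 1)) / (m + (j + 1)) := by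
  obtain ⟨h0, h1⟩ := hα
  set g : ℝ → ℝ := fun u => u ^ (1 / ((j : ℝ) + 1)) with hg
  have hgm : Measurable g := by fun_prop
  set β : Measure ℝ := (volume.restrict (Icc (0 : ℝ) 1)).map g with hβ
  have hprob0 : IsProbabilityMeasure (volume.restrict (Icc (0 : ℝ) 1)) := ⟨by simp⟩
  have hβp : IsProbabilityMeasure β := Measure.isProbabilityMeasure_map hgm.aemeasurable
  have hβ01 : ∀ᵐ x ∂β, x ∈ Icc (0 : ℝ) 1 := by
    refine (ae_map_iff hgm.aemeasurable (measurableSet_Icc (a := (0 : ℝ)) (b := 1))).2 ?_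
    filter_upwards [ae_restrict_mem measurableSet_Icc] with u hu
    exact ⟨Real.rpow_nonneg hu.1 _, Real.rpow_le_one hu.1 hu.2 (by positivity)⟩
  have hβi : ∀ m : ℕ, Integrable (fun x : ℝ => x ^ m) β := by
    intro m
    refine Integrable.of_bound (by fun_prop) 1 ?_
    filter_upwards [hβ01] with x hx
    rw [norm_pow, Real.norm_eq_abs, abs_of_nonneg hx.1]
    exact pow_le_one₀ hx.1 hx.2
  have hβm : ∀ m : ℕ, ∫ x, x ^ m ∂β = ((j : ℝ) + 1) / (m + (j + 1)) := by
    intro m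
    rw [hβ, integral_map hgm.aemeasurable (by fun_prop)]
    have : ∫ u in Icc (0 : ℝ) 1, g u ^ m = ∫ u in Icc (0 : ℝ) 1, u ^ ((m : ℝ) / (j + 1)) := by
      refine setIntegral_congr_fun measurableSet_Icc fun u hu => ?_
      simp only [hg]
      rw [← Real.rpow_natCast, ← Real.rpow_mul hu.1]
      ring_nf
    have hm : (0 : ℝ) ≤ (m : ℝ) / (j + 1) := by positivity
    rw [this, integral_Icc_eq_integral_Ioc, ← intervalIntegral.integral_of_le zero_le_one,
      integral_rpow (Or.inl (by linarith)), Real.one_rpow, Real.zero_rpow (by linarith)]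
    field_simp
    simp
  refine ⟨ENNReal.ofReal α • Measure.dirac 1 + ENNReal.ofReal (1 - α) • β, ⟨?_⟩, ?_, ?_⟩
  · simp only [Measure.add_apply, Measure.smul_apply, measure_univ, smul_eq_mul, mul_one]
    rw [← ENNReal.ofReal_add h0.le (by linarith)]
    simp
  · rw [ae_add_measure_iff]
    constructor
    · refine Measure.ae_smul_measure ?_ _
      exact (ae_dirac_iff (measurableSet_Icc (a := (0 : ℝ)) (b := 1))).2 (by simp)
    · exact Measure.ae_smul_measure hβ01 _
  · intro m
    rw [integral_add_measure, integral_smul_measure, integral_smul_measure, hβm, integral_dirac,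
      ENNReal.toReal_ofReal h0.le, ENNReal.toReal_ofReal (by linarith)]
    · simp only [one_pow, smul_eq_mul]
      field_simp
      ring
    · refine Integrable.smul_measure ?_ ENNReal.ofReal_ne_top
      exact integrable_dirac (by simp)
    · exact (hβi m).smul_measure ENNReal.ofReal_ne_top

lemma exists_measure_moments_prod {α : ℝ} (hα : α ∈ Ioo (0 : ℝ) 1) (K : ℕ) :
    ∃ ν : Measure ℝ, IsProbabilityMeasure ν ∧ (∀ᵐ x ∂ν, x ∈ Icc (0 : ℝ) 1) ∧
      ∀ m : ℕ, ∫ x, x ^ m ∂ν =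
        ∏ j ∈ Finset.range K, (α * m + (j + 1)) / ((m : ℝ) + (j + 1)) := by
  induction K with
  | zero =>
    refine ⟨Measure.dirac 1, inferInstance, ?_, fun m => by simp⟩
    exact (ae_dirac_iff (measurableSet_Icc (a := (0 : ℝ)) (b := 1))).2 (by simp)
  | succ K ih =>
    obtain ⟨ν, hν, hν01, hνm⟩ := ih
    obtain ⟨κ, hκ, hκ01, hκm⟩ := exists_measure_moments_ratio hα K
    have hmul : Measurable (fun z : ℝ × ℝ => z.1 * z.2) := by fun_prop
    refine ⟨(ν.prod κ).map (fun z => z.1 * z.2),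
      Measure.isProbabilityMeasure_map hmul.aemeasurable, ?_, fun m => ?_⟩
    · refine (ae_map_iff hmul.aemeasurable (measurableSet_Icc (a := (0 : ℝ)) (b := 1))).2 ?_
      filter_upwards [Measure.quasiMeasurePreserving_fst.ae hν01,
        Measure.quasiMeasurePreserving_snd.ae hκ01] with z h1 h2
      exact ⟨mul_nonneg h1.1 h2.1, mul_le_one₀ h1.2 h2.1 h2.2⟩
    · rw [integral_map hmul.aemeasurable (by fun_prop)]
      simp only [mul_pow]
      rw [integral_prod_mul (fun x : ℝ => x ^ m) (fun x : ℝ => x ^ m), hνm, hκm,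
        Finset.prod_range_succ]

lemma GammaSeq_ratio_eq {α : ℝ} (hα : 0 < α) {K : ℕ} (hK : 1 ≤ K) (m : ℕ) :
    Real.GammaSeq (m + 1) K / Real.GammaSeq (α * m + 1) K =
      ((K : ℝ) ^ (1 - α)) ^ m *
        ∏ j ∈ Finset.range (K + 1), (α * m + (j + 1)) / ((m : ℝ) + (j + 1)) := by
  have hK0 : (0 : ℝ) < K := by exact_mod_cast hK
  have h1 : (∏ j ∈ Finset.range (K + 1), ((m : ℝ) + (j + 1))) ≠ 0 :=
    Finset.prod_ne_zero_iff.2 fun j _ => by positivity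
  have h2 : (∏ j ∈ Finset.range (K + 1), (α * m + ((j : ℝ) + 1))) ≠ 0 :=
    Finset.prod_ne_zero_iff.2 fun j _ => by positivity
  have e1 : ∏ j ∈ Finset.range (K + 1), ((m : ℝ) + 1 + j) =
      ∏ j ∈ Finset.range (K + 1), ((m : ℝ) + (j + 1)) :=
    Finset.prod_congr rfl fun j _ => by ring
  have e2 : ∏ j ∈ Finset.range (K + 1), (α * m + 1 + (j : ℝ)) =
      ∏ j ∈ Finset.range (K + 1), (α * m + ((j : ℝ) + 1)) :=
    Finset.prod_congr rfl fun j _ => by ring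
  have e3 : (K : ℝ) ^ ((m : ℝ) + 1) = ((K : ℝ) ^ (1 - α)) ^ m * (K : ℝ) ^ (α * m + 1) := by
    rw [← Real.rpow_natCast, ← Real.rpow_mul hK0.le, ← Real.rpow_add hK0]
    ring_nf
  have hf : ((K.factorial : ℕ) : ℝ) ≠ 0 := by positivity
  have hp : (K : ℝ) ^ (α * m + 1) ≠ 0 := by positivity
  rw [Real.GammaSeq, Real.GammaSeq, e1, e2, e3, Finset.prod_div_distrib]
  field_simp

lemma GammaSeq_ratio_le_succ {α : ℝ} (hα : α ∈ Ioo (0 : ℝ) 1) {K : ℕ} (hK : 1 ≤ K) (m : ℕ) :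
    Real.GammaSeq (m + 1) K / Real.GammaSeq (α * m + 1) K ≤
      Real.GammaSeq (m + 1) (K + 1) / Real.GammaSeq (α * m + 1) (K + 1) := by
  obtain ⟨h0, h1⟩ := hα
  have hK0 : (0 : ℝ) < K := by exact_mod_cast hK
  rw [GammaSeq_ratio_eq h0 hK, GammaSeq_ratio_eq h0 (Nat.le_add_left 1 K),
    Finset.prod_range_succ _ (K + 1), mul_comm (∏ j ∈ Finset.range (K + 1), _), ← mul_assoc]
  have hprod : 0 ≤ ∏ j ∈ Finset.range (K + 1), (α * m + (j + 1)) / ((m : ℝ) + (j + 1)) :=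
    Finset.prod_nonneg fun j _ => by positivity
  refine mul_le_mul_of_nonneg_right ?_ hprod
  push_cast
  set e : ℝ := (1 - α) * m with he
  have he0 : 0 ≤ e := mul_nonneg (by linarith) (by positivity)
  have hpow : ∀ x : ℝ, 0 ≤ x → (x ^ (1 - α)) ^ m = x ^ e := by
    intro x hx
    rw [← Real.rpow_natCast, ← Real.rpow_mul hx]
  rw [hpow _ hK0.le, hpow _ (by positivity)]
  have hexp : Real.exp (1 / ((K : ℝ) + 1)) ≤ ((K : ℝ) + 1) / K := by
    have h := Real.one_sub_le_exp_neg (1 / ((K : ℝ) + 1))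
    rw [Real.exp_neg] at h
    have h2 : (K : ℝ) / (K + 1) ≤ (Real.exp (1 / ((K : ℝ) + 1)))⁻¹ := by
      refine le_trans (le_of_eq ?_) h
      field_simp
      ring
    have h3 := inv_anti₀ (by positivity) h2
    rwa [inv_inv, inv_div] at h3
  have hA : (0 : ℝ) < α * m + (K + 1 + 1) := by positivity
  have hratio : ((m : ℝ) + (K + 1 + 1)) / (α * m + (K + 1 + 1)) ≤ (((K : ℝ) + 1) / K) ^ e := by
    calc ((m : ℝ) + (K + 1 + 1)) / (α * m + (K + 1 + 1))
        = e / (α * m + (K + 1 + 1)) + 1 := by rw [he]; field_simp; ring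
      _ ≤ e / (K + 1) + 1 := by
          have : (K : ℝ) + 1 ≤ α * m + (K + 1 + 1) := by
            have : 0 ≤ α * (m : ℝ) := by positivity
            linarith
          gcongr
      _ ≤ Real.exp (e / (K + 1)) := Real.add_one_le_exp _
      _ = Real.exp (1 / ((K : ℝ) + 1)) ^ e := by
          rw [← Real.exp_mul]
          ring_nf
      _ ≤ (((K : ℝ) + 1) / K) ^ e := Real.rpow_le_rpow (Real.exp_pos _).le hexp he0
  rw [Real.div_rpow (by positivity) hK0.le, div_le_div_iff₀ hA (by positivity)] at hratio
  rw [← mul_div_assoc, le_div_iff₀ (by positivity)]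
  linarith

lemma tendsto_GammaSeq_ratio {α : ℝ} (hα : 0 < α) (m : ℕ) :
    Tendsto (fun K : ℕ => Real.GammaSeq (m + 1) (K + 1) / Real.GammaSeq (α * m + 1) (K + 1)) atTop
      (𝓝 (m.factorial / Real.Gamma (α * m + 1))) := by
  have hG : Real.Gamma (α * m + 1) ≠ 0 := (Real.Gamma_pos_of_pos (by positivity)).ne'
  have h := ((Real.GammaSeq_tendsto_Gamma (m + 1)).div
    (Real.GammaSeq_tendsto_Gamma (α * m + 1)) hG).comp (tendsto_add_atTop_nat 1)
  rw [Real.Gamma_nat_eq_factorial] at h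
  exact h

lemma GammaSeq_ratio_le {α : ℝ} (hα : α ∈ Ioo (0 : ℝ) 1) (K m : ℕ) :
    Real.GammaSeq (m + 1) (K + 1) / Real.GammaSeq (α * m + 1) (K + 1) ≤
      m.factorial / Real.Gamma (α * m + 1) := by
  have hmono : Monotone
      (fun K : ℕ => Real.GammaSeq (m + 1) (K + 1) / Real.GammaSeq (α * m + 1) (K + 1)) :=
    monotone_nat_of_le_succ fun K => GammaSeq_ratio_le_succ hα (Nat.le_add_left 1 K) m
  exact hmono.ge_of_tendsto (tendsto_GammaSeq_ratio hα.1 m) K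

lemma rpow_mul_exp_neg_le_Gamma {A s : ℝ} (hA : 0 < A) (hs : 0 ≤ s) :
    A ^ s * Real.exp (-A) ≤ Real.Gamma (s + 1) := by
  have hintegral := Real.GammaIntegral_convergent (s := s + 1) (by linarith)
  have hsub : Ioi A ⊆ Ioi (0 : ℝ) := Ioi_subset_Ioi hA.le
  rw [Real.Gamma_eq_integral (by linarith)]
  calc A ^ s * Real.exp (-A) = ∫ x in Ioi A, A ^ s * Real.exp (-x) := by
        rw [integral_const_mul, integral_exp_neg_Ioi]
    _ ≤ ∫ x in Ioi A, Real.exp (-x) * x ^ (s + 1 - 1) := by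
        refine setIntegral_mono_on ((integrableOn_exp_neg_Ioi A).const_mul _)
          (hintegral.mono_set hsub) measurableSet_Ioi fun x hx => ?_
        rw [mul_comm, add_sub_cancel_right]
        have : A ≤ x := le_of_lt hx
        gcongr
    _ ≤ ∫ x in Ioi (0 : ℝ), Real.exp (-x) * x ^ (s + 1 - 1) := by
        refine setIntegral_mono_set hintegral ?_ hsub.eventuallyLE
        filter_upwards [ae_restrict_mem measurableSet_Ioi] with x hx
        have : (0 : ℝ) < x := hx
        simp only [Pi.zero_apply]
        positivity

lemma summable_pow_div_Gamma {α : ℝ} (hα : 0 < α) {x : ℝ} (hx : 0 ≤ x) :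
    Summable fun m : ℕ => x ^ m / Real.Gamma (α * m + 1) := by
  set A : ℝ := (2 * x + 1) ^ (1 / α) with hA
  have hA0 : 0 < A := by positivity
  have hAα : A ^ α = 2 * x + 1 := by
    rw [hA, ← Real.rpow_mul (by positivity), one_div_mul_cancel hα.ne', Real.rpow_one]
  have hq : x / (2 * x + 1) < 1 := by
    rw [div_lt_one (by positivity)]
    linarith
  refine Summable.of_nonneg_of_le (fun m => ?_) (fun m => ?_)
    ((summable_geometric_of_lt_one (by positivity) hq).mul_left (Real.exp A))
  · have := Real.Gamma_pos_of_pos (show 0 < α * m + 1 by positivity)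
    positivity
  · have h := rpow_mul_exp_neg_le_Gamma hA0 (show 0 ≤ α * (m : ℝ) by positivity)
    rw [Real.rpow_mul hA0.le, hAα, Real.rpow_natCast] at h
    calc x ^ m / Real.Gamma (α * m + 1) ≤ x ^ m / ((2 * x + 1) ^ m * Real.exp (-A)) := by
          gcongr
      _ = Real.exp A * (x / (2 * x + 1)) ^ m := by
          rw [Real.exp_neg, div_pow]
          field_simp

/-- The Laplace transform of a law with bounded support is the generating series of its moments. -/
lemma hasSum_moments_laplace {ν : Measure ℝ} [IsProbabilityMeasure ν] {B : ℝ}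
    (hν : ∀ᵐ r ∂ν, r ∈ Icc (0 : ℝ) B) (x : ℝ) :
    HasSum (fun m : ℕ => (-x) ^ m / m.factorial * ∫ r, r ^ m ∂ν)
      (∫ r, Real.exp (-(r * x)) ∂ν) := by
  have hpow : ∀ m : ℕ, Integrable (fun r : ℝ => r ^ m) ν := by
    intro m
    refine Integrable.of_bound (by fun_prop) (B ^ m) ?_
    filter_upwards [hν] with r hr
    rw [norm_pow, Real.norm_eq_abs, abs_of_nonneg hr.1]
    exact pow_le_pow_left₀ hr.1 hr.2 m
  have h := hasSum_integral_of_summable_integral_norm (μ := ν)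
    (F := fun (m : ℕ) r => (-x) ^ m / m.factorial * r ^ m) (fun m => (hpow m).const_mul _) ?_
  · simp_rw [integral_const_mul] at h
    refine (congrArg (HasSum _) ?_).mpr h
    refine integral_congr_ae (Eventually.of_forall fun r => ?_)
    simp only
    rw [Real.exp_eq_exp_ℝ, NormedSpace.exp_eq_tsum_div]
    refine tsum_congr fun m => ?_
    rw [show -(r * x) = -x * r by ring, mul_pow]
    ring
  · refine Summable.of_nonneg_of_le (fun m => integral_nonneg fun r => norm_nonneg _)
      (fun m => ?_) (Real.summable_pow_div_factorial (|x| * B))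
    calc ∫ r, ‖(-x) ^ m / m.factorial * r ^ m‖ ∂ν ≤ ∫ _, (|x| * B) ^ m / m.factorial ∂ν := by
          refine integral_mono_ae ((hpow m).const_mul _).norm (integrable_const _) ?_
          filter_upwards [hν] with r hr
          rw [norm_mul, norm_div, norm_pow, norm_pow, norm_neg, Real.norm_natCast,
            Real.norm_eq_abs, Real.norm_eq_abs, abs_of_nonneg hr.1, mul_pow, div_mul_eq_mul_div]
          have := pow_le_pow_left₀ hr.1 hr.2 m
          gcongr
      _ = (|x| * B) ^ m / m.factorial := by simp

/-- `x ↦ E_α(-x)` is a pointwise limit of Laplace transforms of probability laws on `[0, ∞)`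
with uniformly bounded mean. -/
lemma exists_measure_laplace_tendsto_mittagLeffler {α : ℝ} (hα : α ∈ Ioo (0 : ℝ) 1) :
    ∃ ν : ℕ → Measure ℝ, (∀ K, IsProbabilityMeasure (ν K)) ∧ (∀ K, ∀ᵐ r ∂ν K, 0 ≤ r) ∧
      (∀ K, Integrable (fun r : ℝ => r) (ν K)) ∧
      (∀ K, ∫ r, r ∂ν K ≤ 1 / Real.Gamma (α + 1)) ∧
      ∀ x : ℝ, 0 ≤ x → Tendsto (fun K => ∫ r, Real.exp (-(r * x)) ∂ν K) atTop
        (𝓝 (mittagLeffler α (-x))) := by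
  have hex : ∀ K : ℕ, ∃ ν : Measure ℝ, IsProbabilityMeasure ν ∧
      (∀ᵐ r ∂ν, r ∈ Icc (0 : ℝ) (((K + 1 : ℕ) : ℝ) ^ (1 - α))) ∧
      ∀ m : ℕ, ∫ r, r ^ m ∂ν =
        Real.GammaSeq (m + 1) (K + 1) / Real.GammaSeq (α * m + 1) (K + 1) := by
    intro K
    obtain ⟨ν, hν, hν01, hνm⟩ := exists_measure_moments_prod hα (K + 1 + 1)
    set c : ℝ := ((K + 1 : ℕ) : ℝ) ^ (1 - α) with hc
    have hc0 : 0 ≤ c := by positivity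
    have hm : Measurable (fun r : ℝ => c * r) := by fun_prop
    refine ⟨ν.map (fun r => c * r), Measure.isProbabilityMeasure_map hm.aemeasurable, ?_,
      fun m => ?_⟩
    · refine (ae_map_iff hm.aemeasurable (measurableSet_Icc (a := (0 : ℝ)) (b := c))).2 ?_
      filter_upwards [hν01] with r hr
      exact ⟨mul_nonneg hc0 hr.1, mul_le_of_le_one_right hc0 hr.2⟩
    · rw [integral_map hm.aemeasurable (by fun_prop),
        GammaSeq_ratio_eq hα.1 (Nat.le_add_left 1 K), ← hνm m, ← integral_const_mul]
      simp only [mul_pow, hc]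
  choose ν hνp hνb hνm using hex
  refine ⟨ν, hνp, fun K => ?_, fun K => ?_, fun K => ?_, fun x hx => ?_⟩
  · filter_upwards [hνb K] with r hr using hr.1
  · have := hνp K
    refine Integrable.of_bound (by fun_prop) (((K + 1 : ℕ) : ℝ) ^ (1 - α)) ?_
    filter_upwards [hνb K] with r hr
    rw [Real.norm_eq_abs, abs_of_nonneg hr.1]
    exact hr.2
  · have h1 := hνm K 1
    have h2 := GammaSeq_ratio_le hα K 1
    rw [← h1] at h2
    simpa using h2
  · have hsum : ∀ K, ∫ r, Real.exp (-(r * x)) ∂ν K =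
        ∑' m : ℕ, (-x) ^ m / m.factorial *
          (Real.GammaSeq (m + 1) (K + 1) / Real.GammaSeq (α * m + 1) (K + 1)) := by
      intro K
      have := hνp K
      rw [← (hasSum_moments_laplace (hνb K) x).tsum_eq]
      simp_rw [hνm K]
    simp_rw [hsum, mittagLeffler]
    refine tendsto_tsum_of_dominated_convergence (summable_pow_div_Gamma hα.1 hx) (fun m => ?_)
      (Eventually.of_forall fun K m => ?_)
    · have h := (tendsto_GammaSeq_ratio hα.1 m).const_mul ((-x) ^ m / m.factorial)
      have hf : ((m.factorial : ℕ) : ℝ) ≠ 0 := by positivity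
      convert h using 2
      field_simp
    · have hnn : 0 ≤ Real.GammaSeq (m + 1) (K + 1) / Real.GammaSeq (α * m + 1) (K + 1) := by
        rw [← hνm K m]
        refine integral_nonneg_of_ae ?_
        filter_upwards [hνb K] with r hr using pow_nonneg hr.1 m
      have hf : (0 : ℝ) < m.factorial := by positivity
      rw [norm_mul, norm_div, norm_pow, norm_neg, Real.norm_natCast, Real.norm_eq_abs,
        Real.norm_eq_abs, abs_of_nonneg hx, abs_of_nonneg hnn]
      calc x ^ m / m.factorial *
            (Real.GammaSeq (m + 1) (K + 1) / Real.GammaSeq (α * m + 1) (K + 1))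
          ≤ x ^ m / m.factorial * (m.factorial / Real.Gamma (α * m + 1)) := by
            have := GammaSeq_ratio_le hα K m
            gcongr
        _ = x ^ m / Real.Gamma (α * m + 1) := by field_simp

end Subordination

section FractionalHeat

open Filter
open scoped Topology

variable {E : Type*} [NormedAddCommGroup E] [InnerProductSpace ℝ E] [FiniteDimensional ℝ E]
  [MeasurableSpace E] [BorelSpace E]

/-- Uniform `L^q` bounds for Fourier multipliers pass to bounded pointwise limits. -/
lemma eLpNorm_fourierInv_mul_le_of_tendsto {m : ℕ → E → ℝ} {m₀ : E → ℝ}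
    (hm : ∀ K, Measurable (m K)) {B : ℝ} (hB : ∀ K ξ, |m K ξ| ≤ B)
    (hlim : ∀ ξ, Tendsto (fun K => m K ξ) atTop (𝓝 (m₀ ξ))) (f : SchwartzMap E ℂ)
    {q C : ℝ≥0∞}
    (hC : ∀ K, eLpNorm (𝓕⁻ (fun ξ : E => (m K ξ : ℂ) * 𝓕 (f : E → ℂ) ξ)) q volume ≤ C) :
    eLpNorm (𝓕⁻ (fun ξ : E => (m₀ ξ : ℂ) * 𝓕 (f : E → ℂ) ξ)) q volume ≤ C := by
  have hfi : Integrable (𝓕 (f : E → ℂ)) := by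
    rw [← SchwartzMap.fourier_coe]
    exact (𝓕 f).integrable
  have hmeas : ∀ K (x : E), AEStronglyMeasurable (fun ξ : E =>
      Real.fourierChar (inner ℝ ξ x) • ((m K ξ : ℂ) * 𝓕 (f : E → ℂ) ξ)) volume := by
    intro K x
    have hinner : Continuous fun ξ : E => inner ℝ ξ x := by fun_prop
    refine AEStronglyMeasurable.smul ?_ ?_
    · exact (continuous_subtype_val.comp
        (Real.continuous_fourierChar.comp hinner)).aestronglyMeasurable
    · exact (Complex.measurable_ofReal.comp (hm K)).aestronglyMeasurable.mul
        hfi.aestronglyMeasurable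
  have hbound : ∀ K (x ξ : E),
      ‖Real.fourierChar (inner ℝ ξ x) • ((m K ξ : ℂ) * 𝓕 (f : E → ℂ) ξ)‖ ≤
        B * ‖𝓕 (f : E → ℂ) ξ‖ := by
    intro K x ξ
    rw [Circle.norm_smul, norm_mul, Complex.norm_real, Real.norm_eq_abs]
    exact mul_le_mul_of_nonneg_right (hB K ξ) (norm_nonneg _)
  refine Lp.eLpNorm_le_of_ae_tendsto (u := atTop) (Eventually.of_forall hC) (fun K => ?_)
    (Eventually.of_forall fun x => ?_)
  · refine Continuous.aestronglyMeasurable ?_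
    have : (𝓕⁻ (fun ξ : E => (m K ξ : ℂ) * 𝓕 (f : E → ℂ) ξ)) = fun x => ∫ ξ,
        Real.fourierChar (inner ℝ ξ x) • ((m K ξ : ℂ) * 𝓕 (f : E → ℂ) ξ) :=
      funext fun x => Real.fourierInv_eq _ x
    rw [this]
    refine continuous_of_dominated (hmeas K)
      (fun x => Eventually.of_forall fun ξ => hbound K x ξ) (hfi.norm.const_mul B)
      (Eventually.of_forall fun ξ => ?_)
    exact (Real.continuous_fourierChar.comp (by fun_prop)).smul continuous_const
  · simp_rw [Real.fourierInv_eq]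
    refine tendsto_integral_of_dominated_convergence _ (fun K => hmeas K x)
      (hfi.norm.const_mul B) (fun K => Eventually.of_forall fun ξ => hbound K x ξ)
      (Eventually.of_forall fun ξ => ?_)
    exact (((Complex.continuous_ofReal.tendsto _).comp (hlim ξ)).mul_const _).const_smul _

lemma abs_integral_exp_sub_le {ν : Measure ℝ} [IsProbabilityMeasure ν] (hν : ∀ᵐ r ∂ν, 0 ≤ r)
    {x y : ℝ} (hx : 0 ≤ x) (hy : 0 ≤ y) :
    |(∫ r, Real.exp (-(r * x)) ∂ν) - ∫ r, Real.exp (-(r * y)) ∂ν| ≤ 1 := by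
  have h : ∀ z : ℝ, 0 ≤ z → 0 ≤ ∫ r, Real.exp (-(r * z)) ∂ν ∧
      ∫ r, Real.exp (-(r * z)) ∂ν ≤ 1 := by
    intro z hz
    refine ⟨integral_nonneg fun r => (Real.exp_pos _).le, ?_⟩
    have hle : ∀ᵐ r ∂ν, ‖Real.exp (-(r * z))‖ ≤ 1 := by
      filter_upwards [hν] with r hr
      rw [Real.norm_eq_abs, Real.abs_exp, Real.exp_le_one_iff]
      nlinarith
    have := norm_integral_le_of_norm_le_const hle
    simp only [probReal_univ, mul_one] at this
    exact (le_abs_self _).trans this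
  rw [abs_le]
  constructor <;> linarith [(h x hx).1, (h x hx).2, (h y hy).1, (h y hy).2]

/-- Smoothing estimate `‖(1-Δ)^{-b} (S_a - S_c) f‖_q ≤ C (a-c)^b ‖f‖_q`, where
`S_a = ∫ e^{raΔ} dν(r)` is a subordinated heat operator. -/
lemma eLpNorm_subordinated_heat_sub_le {ν : Measure ℝ} [IsProbabilityMeasure ν]
    (hν : ∀ᵐ r ∂ν, 0 ≤ r) (hνi : Integrable (fun r : ℝ => r) ν) {M : ℝ} (hM : ∫ r, r ∂ν ≤ M)
    {b a c : ℝ} (hb : 0 < b) (hb1 : b < 1) (hc : 0 ≤ c) (hca : c ≤ a) (f : SchwartzMap E ℂ)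
    {q : ℝ} (hq : 1 ≤ q) :
    eLpNorm (𝓕⁻ (fun ξ : E => (((1 + ‖ξ‖ ^ 2) ^ (-b) *
      ((∫ r, Real.exp (-(r * (a * ‖ξ‖ ^ 2))) ∂ν) - ∫ r, Real.exp (-(r * (c * ‖ξ‖ ^ 2))) ∂ν) : ℝ)
        : ℂ) * 𝓕 (f : E → ℂ) ξ)) (ENNReal.ofReal q) volume ≤
      ENNReal.ofReal (2 / (b * Real.Gamma b) * (1 + M) * (a - c) ^ b) *
        eLpNorm f (ENNReal.ofReal q) volume := by
  have ha : 0 ≤ a := hc.trans hca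
  have hgi := integrable_gammaDensity hb
  have hgm := measurable_gammaDensity b
  have hshift : ∀ e : ℝ, Integrable (fun z : ℝ × ℝ => gammaDensity b (z.2 - z.1 * e))
      (ν.prod volume) := by
    intro e
    have hlin : Measurable fun z : ℝ × ℝ => z.2 - z.1 * e := by fun_prop
    have hm : Measurable fun z : ℝ × ℝ => gammaDensity b (z.2 - z.1 * e) := hgm.comp hlin
    rw [integrable_prod_iff hm.aestronglyMeasurable]
    refine ⟨Eventually.of_forall fun r => hgi.comp_sub_right (r * e), ?_⟩
    refine (integrable_const (∫ v, ‖gammaDensity b v‖)).congr (Eventually.of_forall fun r => ?_)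
    exact (integral_sub_right_eq_self (fun v => ‖gammaDensity b v‖) (r * e)).symm
  have hw : Integrable (fun z : ℝ × ℝ => gammaDensity b (z.2 - z.1 * a) -
      gammaDensity b (z.2 - z.1 * c)) (ν.prod volume) := (hshift a).sub (hshift c)
  have hV : Measurable (fun z : ℝ × ℝ => max z.2 0) := by fun_prop
  have hV0 : ∀ z : ℝ × ℝ, 0 ≤ max z.2 0 := fun z => le_max_right _ _
  have hexpi : ∀ l : ℝ, 0 ≤ l → Integrable (fun r => Real.exp (-(r * l))) ν := by
    intro l hl
    refine Integrable.of_bound (by fun_prop) 1 ?_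
    filter_upwards [hν] with r hr
    rw [Real.norm_eq_abs, Real.abs_exp, Real.exp_le_one_iff]
    nlinarith
  have hmult : ∀ l : ℝ, 0 ≤ l →
      ∫ z : ℝ × ℝ, (gammaDensity b (z.2 - z.1 * a) - gammaDensity b (z.2 - z.1 * c)) *
        Real.exp (-(max z.2 0 * l)) ∂(ν.prod volume) =
      (1 + l) ^ (-b) *
        ((∫ r, Real.exp (-(r * (a * l))) ∂ν) - ∫ r, Real.exp (-(r * (c * l))) ∂ν) := by
    intro l hl
    have hmulexp : ∀ {X : Type} [MeasurableSpace X] {κ : Measure X} {u : X → ℝ} {v : X → ℝ},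
        Integrable u κ → Measurable v →
          Integrable (fun x => u x * Real.exp (-(max (v x) 0 * l))) κ := by
      intro X _ κ u v hu hv
      refine hu.mul_bdd (c := 1) (by fun_prop) (Eventually.of_forall fun x => ?_)
      rw [Real.norm_eq_abs, Real.abs_exp, Real.exp_le_one_iff]
      have := mul_nonneg (le_max_right (v x) 0) hl
      linarith
    rw [integral_prod _ (hmulexp hw measurable_snd), ← integral_sub (hexpi _ (by positivity))
      (hexpi _ (by positivity)), ← integral_const_mul]
    refine integral_congr_ae ?_
    filter_upwards [hν] with r hr
    have h1 := hmulexp (hgi.comp_sub_right (r * a)) measurable_id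
    have h2 := hmulexp (hgi.comp_sub_right (r * c)) measurable_id
    simp only [id] at h1 h2
    simp only [sub_mul]
    rw [integral_sub h1 h2, integral_gammaDensity_sub_mul_exp hb (by positivity) hl,
      integral_gammaDensity_sub_mul_exp hb (by positivity) hl, mul_assoc, mul_assoc]
    ring
  have hac : 0 ≤ a - c := by linarith
  have hmass : ∫ z : ℝ × ℝ, |gammaDensity b (z.2 - z.1 * a) - gammaDensity b (z.2 - z.1 * c)|
      ∂(ν.prod volume) ≤ 2 / (b * Real.Gamma b) * (1 + M) * (a - c) ^ b := by
    rw [integral_prod _ hw.abs]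
    calc ∫ r, (∫ v, |gammaDensity b (v - r * a) - gammaDensity b (v - r * c)|) ∂ν
        ≤ ∫ r, 2 / (b * Real.Gamma b) * (a - c) ^ b * (1 + r) ∂ν := by
          refine integral_mono_ae hw.abs.integral_prod_left
            (((integrable_const 1).add hνi).const_mul _) ?_
          filter_upwards [hν] with r hr
          refine (integral_abs_gammaDensity_sub_le hb hb1
            (mul_le_mul_of_nonneg_left hca hr)).trans ?_
          rw [← mul_sub, Real.mul_rpow hr hac, mul_assoc, mul_comm (r ^ b)]
          have hrb : r ^ b ≤ 1 + r := by
            rcases le_total r 1 with h | h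
            · linarith [Real.rpow_le_one hr h hb.le]
            · have := Real.rpow_le_rpow_of_exponent_le h hb1.le
              rw [Real.rpow_one] at this
              linarith
          gcongr
      _ = 2 / (b * Real.Gamma b) * (a - c) ^ b * (1 + ∫ r, r ∂ν) := by
          rw [integral_const_mul, integral_add (integrable_const 1) hνi]
          simp
      _ ≤ 2 / (b * Real.Gamma b) * (a - c) ^ b * (1 + M) := by gcongr
      _ = 2 / (b * Real.Gamma b) * (1 + M) * (a - c) ^ b := by ring
  have key := eLpNorm_heat_superposition_le (ν.prod volume) hV hV0 hw f hq
  refine le_trans (le_of_eq ?_) (key.trans ?_)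
  · refine congrArg (fun h => eLpNorm (𝓕⁻ h) _ _) (funext fun ξ => ?_)
    rw [hmult _ (by positivity)]
  · gcongr

/-- The `L^q` smoothing estimate for the increments of the Mittag-Leffler multiplier. -/
lemma eLpNorm_mittagLeffler_sub_le {α : ℝ} (hα : α ∈ Ioo (0 : ℝ) 1) {b a c : ℝ} (hb : 0 < b)
    (hb1 : b < 1) (hc : 0 ≤ c) (hca : c ≤ a) (f : SchwartzMap E ℂ) {q : ℝ} (hq : 1 ≤ q) :
    eLpNorm (𝓕⁻ (fun ξ : E => (((1 + ‖ξ‖ ^ 2) ^ (-b) *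
      (mittagLeffler α (-(a * ‖ξ‖ ^ 2)) - mittagLeffler α (-(c * ‖ξ‖ ^ 2))) : ℝ) : ℂ) *
        𝓕 (f : E → ℂ) ξ)) (ENNReal.ofReal q) volume ≤
      ENNReal.ofReal (2 / (b * Real.Gamma b) * (1 + 1 / Real.Gamma (α + 1)) * (a - c) ^ b) *
        eLpNorm f (ENNReal.ofReal q) volume := by
  obtain ⟨ν, hνp, hν0, hνi, hνm, hνlim⟩ := exists_measure_laplace_tendsto_mittagLeffler hα
  have ha : 0 ≤ a := hc.trans hca
  refine eLpNorm_fourierInv_mul_le_of_tendsto (B := 1) (m := fun K ξ => (1 + ‖ξ‖ ^ 2) ^ (-b) *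
      ((∫ r, Real.exp (-(r * (a * ‖ξ‖ ^ 2))) ∂ν K) - ∫ r, Real.exp (-(r * (c * ‖ξ‖ ^ 2))) ∂ν K))
    (fun K => ?_) (fun K ξ => ?_) (fun ξ => ?_) f (fun K => ?_)
  · have hmeas : ∀ e : ℝ, Measurable fun ξ : E => ∫ r, Real.exp (-(r * (e * ‖ξ‖ ^ 2))) ∂ν K := by
      intro e
      have := hνp K
      have hcont : Continuous fun z : E × ℝ => Real.exp (-(z.2 * (e * ‖z.1‖ ^ 2))) := by fun_prop
      exact (hcont.stronglyMeasurable.integral_prod_right' (ν := ν K)).measurable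
    have := hmeas a
    have := hmeas c
    fun_prop
  · have := hνp K
    have h1 := abs_integral_exp_sub_le (hν0 K) (show 0 ≤ a * ‖ξ‖ ^ 2 by positivity)
      (show 0 ≤ c * ‖ξ‖ ^ 2 by positivity)
    have h2 : (1 + ‖ξ‖ ^ 2) ^ (-b) ≤ 1 :=
      Real.rpow_le_one_of_one_le_of_nonpos (by nlinarith [sq_nonneg ‖ξ‖]) (by linarith)
    rw [abs_mul, abs_of_nonneg (by positivity : (0 : ℝ) ≤ (1 + ‖ξ‖ ^ 2) ^ (-b))]
    exact mul_le_one₀ h2 (abs_nonneg _) h1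
  · exact ((hνlim _ (by positivity)).sub (hνlim _ (by positivity))).const_mul _
  · have := hνp K
    exact eLpNorm_subordinated_heat_sub_le (hν0 K) (hνi K) (hνm K) hb hb1 hc hca f hq

end FractionalHeat

lemma rpow_sub_rpow_le_sub_rpow {α s t : ℝ} (hα : α ∈ Ioo (0 : ℝ) 1) (hs : 0 ≤ s) (hst : s ≤ t) :
    t ^ α - s ^ α ≤ (t - s) ^ α := by
  have h := Real.rpow_add_le_add_rpow hs (sub_nonneg.2 hst) hα.1.le hα.2.le
  rw [add_sub_cancel] at h
  linarith

/-- The Fourier transform of the difference of the convolutions of a real function with two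
real kernels. -/
lemma fourier_convolution_sub_ofReal {E : Type*} [NormedAddCommGroup E] [InnerProductSpace ℝ E]
    [FiniteDimensional ℝ E] [MeasurableSpace E] [BorelSpace E] {g h φ : E → ℝ}
    (hg : Integrable g) (hh : Integrable h) (hφ : Integrable φ) (ξ : E) :
    𝓕 (fun x => (((g ⋆[ContinuousLinearMap.lsmul ℝ ℝ] φ) x -
      (h ⋆[ContinuousLinearMap.lsmul ℝ ℝ] φ) x : ℝ) : ℂ)) ξ =
      (𝓕 (fun x => (g x : ℂ)) ξ - 𝓕 (fun x => (h x : ℂ)) ξ) * 𝓕 (fun x => (φ x : ℂ)) ξ := by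
  have hconv : ∀ k : E → ℝ, ∀ x, (((k ⋆[ContinuousLinearMap.lsmul ℝ ℝ] φ) x : ℝ) : ℂ) =
      ((fun x => (k x : ℂ)) ⋆[ContinuousLinearMap.mul ℂ ℂ] fun x => (φ x : ℂ)) x := by
    intro k x
    simp only [convolution_def]
    rw [← integral_complex_ofReal]
    simp
  have hintegral : ∀ k : E → ℝ, Integrable k →
      Integrable ((fun x => (k x : ℂ)) ⋆[ContinuousLinearMap.mul ℂ ℂ] fun x => (φ x : ℂ)) :=
    fun k hk => hk.ofReal.integrable_convolution _ hφ.ofReal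
  have hmul : ∀ k : E → ℝ, Integrable k →
      𝓕 ((fun x => (k x : ℂ)) ⋆[ContinuousLinearMap.mul ℂ ℂ] fun x => (φ x : ℂ)) ξ =
        𝓕 (fun x => (k x : ℂ)) ξ * 𝓕 (fun x => (φ x : ℂ)) ξ :=
    fun k hk => Real.fourier_mul_convolution_eq hk.ofReal hφ.ofReal ξ
  rw [sub_mul, ← hmul g hg, ← hmul h hh]
  simp only [Complex.ofReal_sub, hconv]
  rw [Real.fourier_eq, Real.fourier_eq, Real.fourier_eq,
    ← integral_sub ((Real.fourierIntegral_convergent_iff ξ).2 (hintegral g hg))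
      ((Real.fourierIntegral_convergent_iff ξ).2 (hintegral h hh))]
  simp only [smul_sub]

/-- Hölder continuity in time of the solution operator `T_t^1 φ = p(t,·) * φ`:
`‖T_t^1 φ − T_s^1 φ‖_{H_p^{2θ/α−2}}^p ≤ N |t−s|^{αμp−1} ‖φ‖_{L_p}^p`. -/
theorem fractional_heat_time_holder {d : ℕ} (α θ p μ T : ℝ)
    (hα : α ∈ Ioo (0 : ℝ) 1) (hθ : θ ∈ Ioo (0 : ℝ) α)
    (hp : 1 / (α - θ) < p) (hμ : μ ∈ Ioo (1 / (α * p)) ((α - θ) / α)) (hT : 0 < T)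
    (P : ℝ → EuclideanSpace ℝ (Fin d) → ℝ)
    (hPint : ∀ t : ℝ, 0 < t → Integrable (P t))
    (hPfourier : ∀ t : ℝ, 0 < t → ∀ ξ : EuclideanSpace ℝ (Fin d),
      𝓕 (fun x => ((P t x : ℝ) : ℂ)) ξ =
        ((mittagLeffler α (-(t ^ α) * ‖ξ‖ ^ 2) : ℝ) : ℂ)) :
    ∃ N : ℝ, 0 < N ∧ ∀ (φ : EuclideanSpace ℝ (Fin d) → ℝ),
      ContDiff ℝ (⊤ : ℕ∞) φ → HasCompactSupport φ →
      ∀ s t : ℝ, 0 < s → s < t → t < T →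
        (besselNorm (2 * θ / α - 2) (ENNReal.ofReal p)
            (fun x => (((P t ⋆[ContinuousLinearMap.lsmul ℝ ℝ] φ) x
              - (P s ⋆[ContinuousLinearMap.lsmul ℝ ℝ] φ) x : ℝ) : ℂ))) ^ p ≤
          ENNReal.ofReal (N * |t - s| ^ (α * μ * p - 1)) *
            (eLpNorm φ (ENNReal.ofReal p) volume) ^ p := by
  obtain ⟨hα0, hα1⟩ := hα
  obtain ⟨hθ0, hθα⟩ := hθ
  have hαθ : 0 < α - θ := by linarith
  have hp1 : 1 < p := by
    refine lt_trans ?_ hp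
    rw [lt_div_iff₀ hαθ]
    linarith
  have hp0 : 0 < p := by linarith
  set b : ℝ := 1 - θ / α with hb
  have hαb : α * b = α - θ := by
    rw [hb]
    field_simp
  have hb0 : 0 < b := by
    rw [hb, sub_pos, div_lt_one hα0]
    exact hθα
  have hb1 : b < 1 := by
    have : 0 < θ / α := by positivity
    linarith
  have hγ : (2 * θ / α - 2) / 2 = -b := by
    rw [hb]
    ring
  have hμ' : α * μ * p - 1 ≤ (α - θ) * p := by
    have h := (lt_div_iff₀ hα0).1 hμ.2
    nlinarith
  set C : ℝ := 2 / (b * Real.Gamma b) * (1 + 1 / Real.Gamma (α + 1)) with hC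
  have hC0 : 0 < C := by
    have h1 := Real.Gamma_pos_of_pos hb0
    have h2 := Real.Gamma_pos_of_pos (show 0 < α + 1 by linarith)
    positivity
  refine ⟨C ^ p * T ^ ((α - θ) * p - (α * μ * p - 1)), by positivity, ?_⟩
  intro φ hφ hφc s t hs hst htT
  have hφC : ContDiff ℝ (⊤ : ℕ∞) (fun x => (φ x : ℂ)) := Complex.ofRealCLM.contDiff.comp hφ
  have hφCc : HasCompactSupport (fun x => (φ x : ℂ)) :=
    hφc.comp_left (g := fun r : ℝ => (r : ℂ)) Complex.ofReal_zero
  set f : SchwartzMap (EuclideanSpace ℝ (Fin d)) ℂ := hφCc.toSchwartzMap hφC with hf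
  have hφi : Integrable φ := hφ.continuous.integrable_of_hasCompactSupport hφc
  have hts : 0 < t - s := by linarith
  have hst' : s ^ α ≤ t ^ α := Real.rpow_le_rpow hs.le hst.le hα0.le
  have hbessel : besselNorm (2 * θ / α - 2) (ENNReal.ofReal p)
      (fun x => (((P t ⋆[ContinuousLinearMap.lsmul ℝ ℝ] φ) x
        - (P s ⋆[ContinuousLinearMap.lsmul ℝ ℝ] φ) x : ℝ) : ℂ)) ≤
      ENNReal.ofReal (C * (t - s) ^ (α - θ)) * eLpNorm φ (ENNReal.ofReal p) volume := by
    have hnorm : eLpNorm f (ENNReal.ofReal p) volume = eLpNorm φ (ENNReal.ofReal p) volume :=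
      eLpNorm_congr_norm_ae (Filter.Eventually.of_forall fun x => Complex.norm_real (φ x))
    have key := eLpNorm_mittagLeffler_sub_le (E := EuclideanSpace ℝ (Fin d)) ⟨hα0, hα1⟩ hb0 hb1
      (Real.rpow_nonneg hs.le α) hst' f hp1.le
    rw [hnorm] at key
    refine le_trans (le_of_eq ?_) (key.trans ?_)
    · refine congrArg (fun h => eLpNorm (𝓕⁻ h) _ _) (funext fun ξ => ?_)
      rw [fourier_convolution_sub_ofReal (hPint t (hs.trans hst)) (hPint s hs) hφi,
        hPfourier t (hs.trans hst), hPfourier s hs, hγ,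
        ← Complex.ofReal_cpow (by positivity : (0 : ℝ) ≤ 1 + ‖ξ‖ ^ 2), neg_mul, neg_mul,
        ← mul_assoc, ← Complex.ofReal_sub, ← Complex.ofReal_mul]
      rfl
    · refine mul_le_mul_left (ENNReal.ofReal_le_ofReal ?_) _
      refine mul_le_mul_of_nonneg_left ?_ hC0.le
      rw [← hαb, Real.rpow_mul hts.le]
      exact Real.rpow_le_rpow (by linarith)
        (rpow_sub_rpow_le_sub_rpow ⟨hα0, hα1⟩ hs.le hst.le) hb0.le
  refine (ENNReal.rpow_le_rpow hbessel hp0.le).trans ?_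
  rw [ENNReal.mul_rpow_of_nonneg _ _ hp0.le, ENNReal.ofReal_rpow_of_nonneg (by positivity) hp0.le]
  refine mul_le_mul_left (ENNReal.ofReal_le_ofReal ?_) _
  rw [abs_of_pos hts, Real.mul_rpow hC0.le (by positivity), ← Real.rpow_mul hts.le, mul_assoc]
  refine mul_le_mul_of_nonneg_left ?_ (by positivity)
  calc (t - s) ^ ((α - θ) * p)
      = (t - s) ^ ((α - θ) * p - (α * μ * p - 1)) * (t - s) ^ (α * μ * p - 1) := by
        rw [← Real.rpow_add hts]
        ring_nf
    _ ≤ T ^ ((α - θ) * p - (α * μ * p - 1)) * (t - s) ^ (α * μ * p - 1) := by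
        gcongr
        · linarith
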